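/- Let (f^k)_{k∈ℕ} be a sequence of vector polynomials f^k = (f^k_1, …, f^k_s) : ℝ^n → ℝ^s such that deg f^k_i = d_i = deg f_i for all i and k, and such that for each i the coefficients of f^k_i converge to the corresponding coefficients of f_i as k → ∞ (i.e., for every monomial the coefficient of f^k_i at that monomial converges to the coefficient of f_i). If SOL^w(K_∞, (f^k)^∞) is unbounded for every k, then SOL^w(K_∞, f^∞) is unbounded. (Equivalently, the family of strongly regular vector polynomials of degrees (d_1, …, d_s) is open.) -/

import Mathlib

open Filter Topology MvPolynomial

/-- The asymptotic cone of a set `K ⊆ ℝⁿ`: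
`K_∞ = {v : ∃ t_k → +∞, x_k ∈ K with x_k / t_k → v}`. -/
def asympCone {n : ℕ} (K : Set (Fin n → ℝ)) : Set (Fin n → ℝ) :=
  {v | ∃ (t : ℕ → ℝ) (x : ℕ → (Fin n → ℝ)), (∀ k, x k ∈ K) ∧
    Tendsto t atTop atTop ∧ Tendsto (fun k => (t k)⁻¹ • x k) atTop (nhds v)}

/-- The weak Pareto efficient solution set of the vector function `p` on `C`:
`x* ∈ C` such that for no `x ∈ C` we have `p(x) - p(x*) ∈ -int ℝˢ₊`. -/
def SOLw {n s : ℕ} (C : Set (Fin n → ℝ)) (p : Fin s → (Fin n → ℝ) → ℝ) : Set (Fin n → ℝ) :=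
  {x | x ∈ C ∧ ∀ y ∈ C, ¬ (∀ i, p i y < p i x)}

/-- The Pareto efficient solution set of the vector function `p` on `C`:
`x* ∈ C` such that for no `x ∈ C` we have `p(x) - p(x*) ∈ -ℝˢ₊ \ {0}`. -/
def SOLs {n s : ℕ} (C : Set (Fin n → ℝ)) (p : Fin s → (Fin n → ℝ) → ℝ) : Set (Fin n → ℝ) :=
  {x | x ∈ C ∧ ∀ y ∈ C, ¬ ((∀ i, p i y ≤ p i x) ∧ (∃ i, p i y < p i x))}

/-- The set of global minimizers of the scalar function `q` on `C`. -/
def SOLmin {n : ℕ} (C : Set (Fin n → ℝ)) (q : (Fin n → ℝ) → ℝ) : Set (Fin n → ℝ) :=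
  {x | x ∈ C ∧ ∀ y ∈ C, q x ≤ q y}

/-- The recession polynomial (vector leading term) of `p`, as a function:
`p^∞(x) = lim_{λ→+∞} p(λx)/λ^{deg p}`, i.e. the evaluation of the homogeneous
component of `p` of top degree. -/
noncomputable def recFn {n : ℕ} (p : MvPolynomial (Fin n) ℝ) : (Fin n → ℝ) → ℝ :=
  fun x => eval x (homogeneousComponent p.totalDegree p)

/-- Evaluation of a polynomial, as a function `ℝⁿ → ℝ`. -/
noncomputable def evalFn {n : ℕ} (p : MvPolynomial (Fin n) ℝ) : (Fin n → ℝ) → ℝ :=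
  fun x => eval x p

/-- `⟨∇p^∞(x), y⟩`: the inner product of the gradient of the recession polynomial
of `p` at `x` with `y`. -/
noncomputable def gradRecInner {n : ℕ} (p : MvPolynomial (Fin n) ℝ) (x y : Fin n → ℝ) : ℝ :=
  ∑ j, (eval x (pderiv j (homogeneousComponent p.totalDegree p))) * y j

/-- `x` is a solution of the weak vector complementarity problem
`WVCP(C, ∇f^∞)`. -/
def isWVCPsol {n s : ℕ} (C : Set (Fin n → ℝ)) (f : Fin s → MvPolynomial (Fin n) ℝ)
    (x : Fin n → ℝ) : Prop :=
  x ∈ C ∧ (∀ y ∈ C, ¬ (∀ i, gradRecInner (f i) x y < 0)) ∧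
    ¬ (∀ i, 0 < gradRecInner (f i) x x)

theorem mem_asympCone_iff' {n : ℕ} (K : Set (Fin n → ℝ)) (v : Fin n → ℝ) :
    v ∈ asympCone K ↔ ∀ N : ℕ, ∃ t : ℝ, ∃ x ∈ K, (N : ℝ) ≤ t ∧ dist (t⁻¹ • x) v < 1 / ((N : ℝ) + 1) := by
  constructor
  · rintro ⟨t, x, hx, ht, hl⟩ N
    have h1 := ht.eventually_ge_atTop (N : ℝ)
    have h2 := (Metric.tendsto_nhds.1 hl) (1 / ((N : ℝ) + 1)) (by positivity)
    obtain ⟨k, hk1, hk2⟩ := (h1.and h2).exists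
    exact ⟨t k, x k, hx k, hk1, hk2⟩
  · intro h
    choose t x hx ht hd using h
    refine ⟨t, x, hx, tendsto_atTop_mono ht tendsto_natCast_atTop_atTop, ?_⟩
    rw [tendsto_iff_dist_tendsto_zero]
    exact squeeze_zero (fun _ => dist_nonneg) (fun k => (hd k).le)
      tendsto_one_div_add_atTop_nhds_zero_nat

theorem isClosed_asympCone' {n : ℕ} (K : Set (Fin n → ℝ)) : IsClosed (asympCone K) := by
  rw [← isSeqClosed_iff_isClosed]
  intro u v hu huv
  rw [mem_asympCone_iff']
  intro N
  have hpos : (0 : ℝ) < 1 / ((N : ℝ) + 1) := by positivity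
  obtain ⟨j, hj⟩ := ((Metric.tendsto_nhds.1 huv) _ (half_pos hpos)).exists
  obtain ⟨t, x, hx, ht, hl⟩ := hu j
  obtain ⟨k, hk1, hk2⟩ := ((ht.eventually_ge_atTop (N : ℝ)).and
    ((Metric.tendsto_nhds.1 hl) _ (half_pos hpos))).exists
  refine ⟨t k, x k, hx k, hk1, ?_⟩
  have := dist_triangle ((t k)⁻¹ • x k) (u j) v
  linarith

theorem smul_mem_asympCone' {n : ℕ} (K : Set (Fin n → ℝ)) {v : Fin n → ℝ}
    (hv : v ∈ asympCone K) {c : ℝ} (hc : 0 < c) : c • v ∈ asympCone K := by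
  obtain ⟨t, x, hx, ht, hl⟩ := hv
  refine ⟨fun k => c⁻¹ * t k, x, hx, ht.const_mul_atTop (inv_pos.2 hc), ?_⟩
  have := hl.const_smul c
  refine this.congr fun k => ?_
  rw [mul_inv, inv_inv, smul_smul]

theorem recFn_smul' {n : ℕ} (p : MvPolynomial (Fin n) ℝ) (c : ℝ) (x : Fin n → ℝ) :
    recFn p (c • x) = c ^ p.totalDegree * recFn p x := by
  have := (homogeneousComponent_isHomogeneous p.totalDegree p)
  unfold recFn
  rw [MvPolynomial.eval_eq, MvPolynomial.eval_eq, Finset.mul_sum]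
  refine Finset.sum_congr rfl fun m hm => ?_
  have hd : m.degree = p.totalDegree := by
    have h2 := this (mem_support_iff.1 hm)
    exact (DFunLike.congr_fun Finsupp.degree_eq_weight_one m).trans h2
  simp only [Pi.smul_apply, smul_eq_mul, mul_pow, Finset.prod_mul_distrib]
  rw [Finset.prod_pow_eq_pow_sum, show ∑ i ∈ m.support, m i = p.totalDegree from hd]
  ring

theorem recFn_eq' {n : ℕ} (p : MvPolynomial (Fin n) ℝ) (x : Fin n → ℝ) :
    recFn p x = ∑ m ∈ Finset.finsuppAntidiag Finset.univ p.totalDegree,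
      p.coeff m * ∏ i, x i ^ m i := by
  unfold recFn
  rw [MvPolynomial.eval_eq']
  refine (Finset.sum_subset (fun m hm => ?_) (fun m _ hm => ?_)).trans
    (Finset.sum_congr rfl fun m hm => ?_)
  · have h2 := (homogeneousComponent_isHomogeneous p.totalDegree p) (mem_support_iff.1 hm)
    rw [Finset.mem_finsuppAntidiag]
    refine ⟨?_, Finset.subset_univ _⟩
    rw [← Finsupp.degree_eq_sum]
    exact (DFunLike.congr_fun Finsupp.degree_eq_weight_one m).trans h2
  · rw [notMem_support_iff.1 hm, zero_mul]
  · rw [coeff_homogeneousComponent, if_pos]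
    rw [Finset.mem_finsuppAntidiag] at hm
    rw [Finsupp.degree_eq_sum]; exact hm.1

theorem smul_mem_SOLw' {n s : ℕ} (K : Set (Fin n → ℝ)) (f : Fin s → MvPolynomial (Fin n) ℝ)
    {v : Fin n → ℝ} (hv : v ∈ SOLw (asympCone K) (fun i => recFn (f i))) {c : ℝ} (hc : 0 < c) :
    c • v ∈ SOLw (asympCone K) (fun i => recFn (f i)) := by
  refine ⟨smul_mem_asympCone' K hv.1 hc, fun y hy h => ?_⟩
  refine hv.2 (c⁻¹ • y) (smul_mem_asympCone' K hy (inv_pos.2 hc)) fun i => ?_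
  have h1 := h i
  simp only [recFn_smul'] at h1 ⊢
  rw [inv_pow, inv_mul_lt_iff₀ (pow_pos hc _)]
  exact h1

theorem tendsto_recFn' {n : ℕ} (p : MvPolynomial (Fin n) ℝ) (P : ℕ → MvPolynomial (Fin n) ℝ)
    (hd : ∀ k, (P k).totalDegree = p.totalDegree)
    (hc : ∀ m, Tendsto (fun k => (P k).coeff m) atTop (nhds (p.coeff m)))
    (φ : ℕ → ℕ) (hφ : Tendsto φ atTop atTop)
    (u : ℕ → Fin n → ℝ) (x : Fin n → ℝ) (hu : Tendsto u atTop (nhds x)) :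
    Tendsto (fun k => recFn (P (φ k)) (u k)) atTop (nhds (recFn p x)) := by
  simp only [recFn_eq', hd]
  refine tendsto_finsetSum _ fun m _ => ((hc m).comp hφ).mul (tendsto_finsetProd _ fun i _ => ?_)
  exact ((tendsto_pi_nhds.1 hu) i).pow _

theorem stmt19 {n s : ℕ} (hs : 0 < s) (K : Set (Fin n → ℝ)) (hK : K.Nonempty) (hKc : IsClosed K)
    (f : Fin s → MvPolynomial (Fin n) ℝ) (hdeg : ∀ i, 1 ≤ (f i).totalDegree)
    (F : ℕ → Fin s → MvPolynomial (Fin n) ℝ)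
    (hdegF : ∀ k i, (F k i).totalDegree = (f i).totalDegree)
    (hcoeff : ∀ i m, Tendsto (fun k => (F k i).coeff m) atTop (nhds ((f i).coeff m)))
    (hunb : ∀ k, ¬ Bornology.IsBounded (SOLw (asympCone K) (fun i => recFn (F k i)))) :
    ¬ Bornology.IsBounded (SOLw (asympCone K) (fun i => recFn (f i))) := by
  have hex : ∀ k, ∃ x ∈ SOLw (asympCone K) (fun i => recFn (F k i)), ‖x‖ = 1 := by
    intro k
    by_contra hcon
    push Not at hcon
    apply hunb k
    refine Bornology.isBounded_singleton (x := (0 : Fin n → ℝ)) |>.subset fun x hx => ?_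
    by_contra hx0
    have hx0 : x ≠ 0 := hx0
    exact hcon _ (smul_mem_SOLw' K (F k) hx (inv_pos.2 (norm_pos_iff.2 hx0)))
      (by rw [norm_smul, norm_inv, norm_norm, inv_mul_cancel₀ (norm_ne_zero_iff.2 hx0)])
  choose u hu hu1 using hex
  obtain ⟨x, hx, φ, hφ, hl⟩ := (isCompact_sphere (0 : Fin n → ℝ) 1).tendsto_subseq
    (x := u) (fun k => by simp [hu1 k])
  have hx1 : ‖x‖ = 1 := by simpa using hx
  have hxS : x ∈ SOLw (asympCone K) (fun i => recFn (f i)) := by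
    refine ⟨(isClosed_asympCone' K).mem_of_tendsto hl (Eventually.of_forall fun k => (hu _).1),
      fun y hy h => ?_⟩
    have hev : ∀ᶠ k in atTop, ∀ i, recFn (F (φ k) i) y < recFn (F (φ k) i) (u (φ k)) := by
      rw [eventually_all]
      intro i
      have a := tendsto_recFn' (f i) (fun k => F k i) (fun k => hdegF k i) (hcoeff i) φ
        hφ.tendsto_atTop (fun _ => y) y tendsto_const_nhds
      have b := tendsto_recFn' (f i) (fun k => F k i) (fun k => hdegF k i) (hcoeff i) φ
        hφ.tendsto_atTop (u ∘ φ) x hl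
      exact a.eventually_lt b (h i)
    obtain ⟨k, hk⟩ := hev.exists
    exact (hu (φ k)).2 y hy hk
  intro hb
  obtain ⟨R, hR⟩ := hb.exists_norm_le
  have h1 := hR _ (smul_mem_SOLw' K f hxS (c := |R| + 1) (by positivity))
  rw [norm_smul, hx1, Real.norm_eq_abs, abs_of_pos (by positivity)] at h1
  linarith [le_abs_self R]
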